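/- arXiv:2509.11806 — 2 statements merged into one kernel-verified Lean document; each statement's English description precedes it below -/
import Mathlib

section
/- Let (G, ν) be a computable numbered group with ν bijective. Let S ⊆ ℕ be the set of all m such that the m-th partial computable function φ_m is total, for every k the value φ_m(k) is the canonical index of a nonempty finite set F_k ⊆ ℕ, and (ν(F_k))_{k∈ℕ} is a Følner sequence in G, i.e., for every g ∈ G, |ν(F_k) \ g·ν(F_k)| / |ν(F_k)| → 0 as k → ∞. Then S is a Π⁰₃ set: there exists a decidable relation R ⊆ ℕ⁴ such that S = {m ∈ ℕ : ∀a ∃b ∀c, R(m, a, b, c)}. -/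
open Filter Topology

/-- The `m`-th partial computable function `ℕ →. ℕ` under the standard numbering. -/
def phi (m : ℕ) : ℕ →. ℕ := (Denumerable.ofNat Nat.Partrec.Code m).eval

namespace FolnerAux

theorem encode_spec_aux (s : Finset ℕ) (r : ℕ → ℕ → Prop) {i1 : DecidableRel r} {i2 : IsTrans ℕ r}
    {i3 : Std.Antisymm r} {i4 : Std.Total r} (hr : ∀ a b, r a b → a ≤ b)
    (h : Encodable.encode s = Encodable.encode (Multiset.sort s.val r)) :
    ∃ l : List ℕ, Encodable.encode s = Encodable.encode l ∧ l.Pairwise (· ≤ ·) ∧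
      (l : Multiset ℕ) = s.val :=
  ⟨Multiset.sort s.val r, h, (Multiset.pairwise_sort _ _).imp (fun {a b} => hr a b),
    Multiset.sort_eq _ _⟩

theorem encode_spec (s : Finset ℕ) :
    ∃ l : List ℕ, Encodable.encode s = Encodable.encode l ∧ l.Pairwise (· < ·) ∧
      l.toFinset = s := by
  have key : ∃ l : List ℕ, Encodable.encode s = Encodable.encode l ∧ l.Pairwise (· ≤ ·) ∧
      (l : Multiset ℕ) = s.val :=
    encode_spec_aux s _ (fun _ _ h => h) rfl
  obtain ⟨l, h1, h2, h3⟩ := key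
  have hn : l.Nodup := by
    have := s.nodup
    rw [← h3] at this
    exact Multiset.coe_nodup.1 this
  refine ⟨l, h1, ?_, ?_⟩
  · exact (h2.and hn).imp (fun ⟨a, b⟩ => lt_of_le_of_ne a b)
  · ext x
    rw [List.mem_toFinset, ← Finset.mem_val, ← h3, Multiset.mem_coe]

/-- strict sortedness test -/
def sortedB (l : List ℕ) : Bool :=
  List.recOn l true (fun b l IH => IH && (decide (l.length = 0) || decide (b < l.headI)))

theorem sortedB_iff (l : List ℕ) : sortedB l = true ↔ l.Pairwise (· < ·) := by
  rw [← List.isChain_iff_pairwise]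
  induction l with
  | nil => simp [sortedB]
  | cons b l ih =>
    have : sortedB (b :: l) = (sortedB l && (decide (l.length = 0) || decide (b < l.headI))) := rfl
    rw [this]
    cases l with
    | nil => simp [sortedB]
    | cons c l => rw [Bool.and_eq_true, ih]; simp [and_comm]; exact fun _ => decide_eq_true_iff

theorem sortedB_primrec : Primrec sortedB := by
  unfold sortedB
  refine Primrec.list_rec (h := fun _ p => p.2.2 && (decide (p.2.1.length = 0) || decide (p.1 < p.2.1.headI)))
    Primrec.id (Primrec.const true) ?_
  refine Primrec.and.comp (Primrec.snd.comp (Primrec.snd.comp Primrec.snd)) ?_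
  have hl : Primrec (fun p : List ℕ × (ℕ × List ℕ × Bool) => p.2.2.1) :=
    Primrec.fst.comp (Primrec.snd.comp Primrec.snd)
  refine Primrec.or.comp ?_ ?_
  · exact (Primrec.eq.comp (Primrec.list_length.comp hl) (Primrec.const 0)).decide
  · exact (Primrec.nat_lt.comp (Primrec.fst.comp Primrec.snd) (Primrec.list_headI.comp hl)).decide

def good (n : ℕ) : Bool :=
  sortedB (Denumerable.ofNat (List ℕ) n) && decide (0 < (Denumerable.ofNat (List ℕ) n).length)

theorem good_primrec : Primrec good := by
  have h := Primrec.ofNat (List ℕ)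
  exact Primrec.and.comp (sortedB_primrec.comp h)
    (Primrec.nat_lt.comp (Primrec.const 0) (Primrec.list_length.comp h)).decide

/-- the finite set with code n -/
def fs (n : ℕ) : Finset ℕ := (Denumerable.ofNat (List ℕ) n).toFinset

theorem good_spec (n : ℕ) (h : good n = true) :
    Encodable.encode (fs n) = n ∧ (fs n).Nonempty ∧ (Denumerable.ofNat (List ℕ) n).Nodup := by
  simp only [good, Bool.and_eq_true, sortedB_iff, decide_eq_true_eq] at h
  obtain ⟨h1, h2⟩ := h
  refine ⟨?_, ?_, h1.imp (fun h => ne_of_lt h)⟩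
  · obtain ⟨l, e1, e2, e3⟩ := encode_spec (fs n)
    have : l = Denumerable.ofNat (List ℕ) n := by
      refine List.Perm.eq_of_pairwise (le := (· < ·)) (fun a b _ _ h1 h2 => absurd h1 (lt_asymm h2)) e2 h1 ?_
      exact (List.toFinset_eq_iff_perm_dedup.1 e3).trans
        (by rw [List.Nodup.dedup (h1.imp (fun h => ne_of_lt h))]) |> fun h => by
          rwa [List.Nodup.dedup (e2.imp (fun h => ne_of_lt h))] at h
    rw [e1, this, Denumerable.encode_ofNat]
  · obtain ⟨x, hx⟩ := List.exists_mem_of_length_pos h2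
    exact ⟨x, by simpa [fs] using hx⟩

theorem good_encode (s : Finset ℕ) (hs : s.Nonempty) :
    good (Encodable.encode s) = true ∧ fs (Encodable.encode s) = s := by
  obtain ⟨l, e1, e2, e3⟩ := encode_spec s
  have : Denumerable.ofNat (List ℕ) (Encodable.encode s) = l := by
    rw [e1, Denumerable.ofNat_encode]
  constructor
  · simp only [good, this, Bool.and_eq_true, sortedB_iff, decide_eq_true_eq]
    refine ⟨e2, ?_⟩
    obtain ⟨x, hx⟩ := hs
    rw [← e3, List.mem_toFinset] at hx
    exact List.length_pos_of_mem hx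
  · rw [fs, this, e3]

def cnt (mul : ℕ → ℕ → ℕ) (inv : ℕ → ℕ) (g : ℕ) (l : List ℕ) : ℕ :=
  Nat.rec 0 (fun i acc => acc +
    cond (decide (l.idxOf (mul (inv g) (l.getD i 0)) < l.length)) 0 1) l.length

theorem cnt_comp {mul : ℕ → ℕ → ℕ} {inv : ℕ → ℕ} (hm : Computable₂ mul) (hi : Computable inv) :
    Computable₂ (cnt mul inv) := by
  unfold cnt
  refine Computable.nat_rec (f := fun p : ℕ × List ℕ => p.2.length) (g := fun _ => 0)
    (h := fun (p : ℕ × List ℕ) (q : ℕ × ℕ) => q.2 +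
      cond (decide (p.2.idxOf (mul (inv p.1) (p.2.getD q.1 0)) < p.2.length)) 0 1)
    (Computable.list_length.comp Computable.snd) (Computable.const 0) ?_
  have hl : Computable (fun p : (ℕ × List ℕ) × (ℕ × ℕ) => p.1.2) :=
    Computable.snd.comp Computable.fst
  refine Primrec.nat_add.to_comp.comp (Computable.snd.comp Computable.snd) ?_
  refine Computable.cond ?_ (Computable.const 0) (Computable.const 1)
  have hlt : Computable₂ (fun a b : ℕ => decide (a < b)) := Primrec.nat_lt.decide.to_comp
  refine hlt.comp ?_ (Computable.list_length.comp hl)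
  refine Primrec.list_idxOf.to_comp.comp ?_ hl
  refine hm.comp (hi.comp (Computable.fst.comp Computable.fst)) ?_
  exact (Primrec.list_getD 0).to_comp.comp hl (Computable.fst.comp Computable.snd)

theorem rec_eq_sum (f : ℕ → ℕ) (n : ℕ) :
    (Nat.rec 0 (fun i acc => acc + f i) n : ℕ) = ∑ i ∈ Finset.range n, f i := by
  induction n with
  | zero => rfl
  | succ n ih => rw [Finset.sum_range_succ, ← ih]

theorem sum_getD (f : ℕ → ℕ) (l : List ℕ) :
    ∑ i ∈ Finset.range l.length, f (l.getD i 0) = (l.map f).sum := by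
  induction l with
  | nil => rfl
  | cons a l ih =>
    rw [List.length_cons, Finset.sum_range_succ', List.map_cons, List.sum_cons, ← ih, add_comm]
    rfl

theorem cnt_eq {G : Type} [Group G] [DecidableEq G] {ν : ℕ → G} (hinj : Function.Injective ν)
    {mul : ℕ → ℕ → ℕ} {inv : ℕ → ℕ}
    (hmulν : ∀ i j, ν (mul i j) = ν i * ν j) (hinvν : ∀ i, ν (inv i) = (ν i)⁻¹)
    (g : ℕ) (l : List ℕ) (hl : l.Nodup) :
    cnt mul inv g l =
      ((l.toFinset.image ν) \ ((l.toFinset.image ν).image (ν g * ·))).card := by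
  unfold cnt
  rw [rec_eq_sum (fun i => cond (decide (l.idxOf (mul (inv g) (l.getD i 0)) < l.length)) 0 1),
    sum_getD (fun x => cond (decide (l.idxOf (mul (inv g) x) < l.length)) 0 1),
    ← List.sum_toFinset _ hl]
  have : ((l.toFinset.image ν) \ ((l.toFinset.image ν).image (ν g * ·))) =
      (l.toFinset.filter (fun x => ¬ mul (inv g) x ∈ l)).image ν := by
    ext y
    simp only [Finset.mem_sdiff, Finset.mem_image, Finset.mem_filter, List.mem_toFinset]
    constructor
    · rintro ⟨⟨x, hx, rfl⟩, h⟩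
      refine ⟨x, ⟨hx, fun hm => h ⟨_, ⟨_, hm, rfl⟩, ?_⟩⟩, rfl⟩
      simp [hmulν, hinvν]
    · rintro ⟨x, ⟨hx, h⟩, rfl⟩
      refine ⟨⟨x, hx, rfl⟩, ?_⟩
      rintro ⟨_, ⟨z, hz, rfl⟩, e⟩
      apply h
      have : mul (inv g) x = z := by
        apply hinj
        simp [hmulν, hinvν, ← e]
      rwa [this]
  rw [this, Finset.card_image_of_injective _ hinj, Finset.card_filter]
  refine Finset.sum_congr rfl fun x _ => ?_
  by_cases hx : mul (inv g) x ∈ l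
  · simp [List.idxOf_lt_length_iff, hx]
  · simp [List.idxOf_lt_length_iff, hx]

def ev (m k s : ℕ) : Option ℕ := Nat.Partrec.Code.evaln s (Denumerable.ofNat Nat.Partrec.Code m) k

theorem ev_spec (m k n : ℕ) : n ∈ phi m k ↔ ∃ s, ev m k s = some n :=
  Nat.Partrec.Code.evaln_complete

theorem ev_comp {α : Type} [Primcodable α] {f g h : α → ℕ} (hf : Computable f) (hg : Computable g)
    (hh : Computable h) : Computable (fun a => ev (f a) (g a) (h a)) :=
  Nat.Partrec.Code.primrec_evaln.to_comp.comp
    ((hh.pair ((Primrec.ofNat Nat.Partrec.Code).to_comp.comp hf)).pair hg)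

def RR (mul : ℕ → ℕ → ℕ) (inv : ℕ → ℕ) (m a b c : ℕ) : Bool :=
  (Option.casesOn (ev m a b.unpair.1) false good : Bool) &&
  (decide (c.unpair.1 < b.unpair.2) ||
    (Option.casesOn (ev m c.unpair.1 c.unpair.2) true (fun n =>
      decide (cnt mul inv a.unpair.1 (Denumerable.ofNat (List ℕ) n) * (a.unpair.2 + 1) ≤
        (Denumerable.ofNat (List ℕ) n).length)) : Bool))

theorem RR_comp {mul : ℕ → ℕ → ℕ} {inv : ℕ → ℕ} (hm : Computable₂ mul) (hi : Computable inv) :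
    Computable (fun p : ℕ × ℕ × ℕ × ℕ => RR mul inv p.1 p.2.1 p.2.2.1 p.2.2.2) := by
  have h1 : Computable (fun p : ℕ × ℕ × ℕ × ℕ => p.1) := Computable.fst
  have h2 : Computable (fun p : ℕ × ℕ × ℕ × ℕ => p.2.1) := Computable.fst.comp Computable.snd
  have h3 : Computable (fun p : ℕ × ℕ × ℕ × ℕ => p.2.2.1) :=
    Computable.fst.comp (Computable.snd.comp Computable.snd)
  have h4 : Computable (fun p : ℕ × ℕ × ℕ × ℕ => p.2.2.2) :=
    Computable.snd.comp (Computable.snd.comp Computable.snd)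
  have hlt : Computable₂ (fun a b : ℕ => decide (a < b)) := Primrec.nat_lt.decide.to_comp
  have hle : Computable₂ (fun a b : ℕ => decide (a ≤ b)) := Primrec.nat_le.decide.to_comp
  have u1 : Computable (fun n : ℕ => n.unpair.1) := Computable.fst.comp Computable.unpair
  have u2 : Computable (fun n : ℕ => n.unpair.2) := Computable.snd.comp Computable.unpair
  unfold RR
  refine Primrec.and.to_comp.comp ?_ (Primrec.or.to_comp.comp ?_ ?_)
  · exact Computable.option_casesOn (o := fun p : ℕ × ℕ × ℕ × ℕ => ev p.1 p.2.1 p.2.2.1.unpair.1)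
      (f := fun _ => false) (g := fun _ n => good n) (ev_comp h1 h2 (u1.comp h3)) (Computable.const false)
      (good_primrec.to_comp.comp Computable.snd).to₂
  · exact hlt.comp (u1.comp h4) (u2.comp h3)
  · refine Computable.option_casesOn
      (o := fun p : ℕ × ℕ × ℕ × ℕ => ev p.1 p.2.2.2.unpair.1 p.2.2.2.unpair.2)
      (f := fun _ => true) (ev_comp h1 (u1.comp h4) (u2.comp h4)) (Computable.const true)
      ?_ (g := fun p n => decide (cnt mul inv p.2.1.unpair.1
        (Denumerable.ofNat (List ℕ) n) * (p.2.1.unpair.2 + 1) ≤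
        (Denumerable.ofNat (List ℕ) n).length))
    have hl : Computable (fun q : (ℕ × ℕ × ℕ × ℕ) × ℕ => Denumerable.ofNat (List ℕ) q.2) :=
      (Primrec.ofNat (List ℕ)).to_comp.comp Computable.snd
    have ha := h2.comp (Computable.fst (α := ℕ × ℕ × ℕ × ℕ) (β := ℕ))
    refine Computable₂.mk (hle.comp (Primrec.nat_mul.to_comp.comp ?_ ?_) (Computable.list_length.comp hl))
    · exact (cnt_comp hm hi).comp (u1.comp ha) hl
    · exact Computable.succ.comp (u2.comp ha)

theorem RR_iff (mul : ℕ → ℕ → ℕ) (inv : ℕ → ℕ) (m a b c : ℕ) :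
    RR mul inv m a b c = true ↔
      (∃ n, ev m a b.unpair.1 = some n ∧ good n = true) ∧
      (b.unpair.2 ≤ c.unpair.1 → ∀ n, ev m c.unpair.1 c.unpair.2 = some n →
        cnt mul inv a.unpair.1 (Denumerable.ofNat (List ℕ) n) * (a.unpair.2 + 1) ≤
        (Denumerable.ofNat (List ℕ) n).length) := by
  unfold RR
  rw [Bool.and_eq_true, Bool.or_eq_true, decide_eq_true_eq]
  refine and_congr ?_ ?_
  · cases ev m a b.unpair.1 <;> simp
  · rw [← not_le, ← imp_iff_not_or]
    cases ev m c.unpair.1 c.unpair.2 <;> simp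

end FolnerAux

open FolnerAux

theorem stmt5 (G : Type) [Group G] [DecidableEq G] (ν : ℕ → G)
    (hbij : Function.Bijective ν)
    (mul : ℕ → ℕ → ℕ) (inv : ℕ → ℕ)
    (hmulc : Computable₂ mul) (hinvc : Computable inv)
    (hmulν : ∀ i j, ν (mul i j) = ν i * ν j) (hinvν : ∀ i, ν (inv i) = (ν i)⁻¹)
    (hcomp : ComputablePred fun p : ℕ × ℕ => ν p.1 = ν p.2) :
    -- S is a Π⁰₃ set
    ∃ R : ℕ → ℕ → ℕ → ℕ → Bool,
      Computable (fun p : ℕ × ℕ × ℕ × ℕ => R p.1 p.2.1 p.2.2.1 p.2.2.2) ∧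
      ∀ m : ℕ,
        -- m ∈ S : φ_m is total, each value φ_m(k) is the canonical index of a nonempty
        -- finite set F_k ⊆ ℕ, and (ν(F_k)) is a Følner sequence in G
        ((∃ F : ℕ → Finset ℕ,
            (∀ k, Encodable.encode (F k) ∈ phi m k) ∧ (∀ k, (F k).Nonempty) ∧
            ∀ g : G, Tendsto
              (fun k : ℕ => ((((F k).image ν) \ (((F k).image ν).image (g * ·))).card : ℝ) /
                ((F k).image ν).card)
              atTop (nhds 0))
          ↔ ∀ a : ℕ, ∃ b : ℕ, ∀ c : ℕ, R m a b c = true) := by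
  refine ⟨RR mul inv, RR_comp hmulc hinvc, fun m => ?_⟩
  have hratio : ∀ (n g j : ℕ), good n = true →
      (cnt mul inv g (Denumerable.ofNat (List ℕ) n) * (j + 1) ≤
        (Denumerable.ofNat (List ℕ) n).length ↔
      (((((fs n).image ν) \ (((fs n).image ν).image (ν g * ·))).card : ℝ) /
                ((fs n).image ν).card) ≤ 1 / ((j : ℝ) + 1)) := by
    intro n g j hg
    obtain ⟨-, hne, hnd⟩ := good_spec n hg
    rw [cnt_eq hbij.1 hmulν hinvν g _ hnd, ← List.toFinset_card_of_nodup hnd]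
    change _ * (j + 1) ≤ (fs n).card ↔ _
    have hc : 0 < (fs n).card := hne.card_pos
    rw [Finset.card_image_of_injective (fs n) hbij.1, div_le_div_iff₀ (by exact_mod_cast hc)
      (by positivity), one_mul]
    norm_cast
  constructor
  · rintro ⟨F, hF, hne, hT⟩ a
    obtain ⟨s, hs⟩ := (ev_spec _ _ _).1 (hF a)
    have hev := (hT (ν a.unpair.1)).eventually
      (Iic_mem_nhds (show (0 : ℝ) < 1 / ((a.unpair.2 : ℝ) + 1) by positivity))
    obtain ⟨K, hK⟩ := eventually_atTop.1 hev
    refine ⟨Nat.pair s K, fun c => (RR_iff ..).2 ?_⟩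
    rw [Nat.unpair_pair]
    refine ⟨⟨_, hs, (good_encode _ (hne a)).1⟩, fun hc n hn => ?_⟩
    have hn' : n ∈ phi m c.unpair.1 := (ev_spec _ _ _).2 ⟨_, hn⟩
    have e := Part.mem_unique hn' (hF _)
    subst e
    obtain ⟨g1, g2⟩ := good_encode _ (hne c.unpair.1)
    rw [hratio _ _ _ g1, g2]
    exact hK _ hc
  · intro h
    have hR : ∀ a, ∃ b, ∀ c, _ := fun a => (h a).imp fun b hb c => (RR_iff ..).1 (hb c)
    have hn : ∀ k, ∃ n, n ∈ phi m k ∧ good n = true := by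
      intro k
      obtain ⟨b, hb⟩ := hR k
      obtain ⟨n, h1, h2⟩ := (hb 0).1
      exact ⟨n, (ev_spec _ _ _).2 ⟨_, h1⟩, h2⟩
    choose f hf hg using hn
    refine ⟨fun k => fs (f k), fun k => ?_, fun k => (good_spec _ (hg k)).2.1, fun g => ?_⟩
    · rw [(good_spec _ (hg k)).1]
      exact hf k
    · obtain ⟨g, rfl⟩ := hbij.2 g
      rw [Metric.tendsto_atTop]
      intro ε hε
      obtain ⟨j, hj⟩ := exists_nat_one_div_lt hε
      obtain ⟨b, hb⟩ := hR (Nat.pair g j)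
      refine ⟨b.unpair.2, fun k hk => ?_⟩
      obtain ⟨s, hs⟩ := (ev_spec _ _ _).1 (hf k)
      have := (hb (Nat.pair k s)).2
      rw [Nat.unpair_pair, Nat.unpair_pair] at this
      have := (hratio _ _ _ (hg k)).1 (this hk _ hs)
      rw [Real.dist_0_eq_abs, abs_of_nonneg (by positivity)]
      exact lt_of_le_of_lt this hj
end

section
/- Let G = ⊕_{n∈ℕ} ℤ be the direct sum of countably many copies of ℤ (the group of finitely supported functions ℕ → ℤ), with its standard effective bijective numbering ν : ℕ → G. There exists a total computable function h : ℕ → ℕ such that for every e ∈ ℕ: the partial computable function φ_{h(e)} is total and each value φ_{h(e)}(s) is the canonical index of a nonempty finite set F_s ⊆ ℕ; and the sequence (ν(F_s))_{s∈ℕ} is a Følner sequence in G (for every g ∈ G, |ν(F_s) \ g·ν(F_s)| / |ν(F_s)| → 0 as s → ∞) if and only if for every n ∈ ℕ the set {x ∈ ℕ : φ_e(n) converges to some c and x lies in the domain W_c of φ_c} is finite. -/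
open Filter Topology

/-- `(ν(F_s))_{s}` is a Følner sequence in the additive group `⊕_{n∈ℕ} ℤ` of finitely
supported functions `ℕ → ℤ`: for every `g`, `|ν(F_s) \ (g + ν(F_s))| / |ν(F_s)| → 0`. -/
def IsFolnerSeq (ν : ℕ → (ℕ →₀ ℤ)) (F : ℕ → Finset ℕ) : Prop :=
  ∀ g : ℕ →₀ ℤ, Tendsto
    (fun s : ℕ => ((((F s).image ν) \ (((F s).image ν).image (g + ·))).card : ℝ) /
      ((F s).image ν).card)
    atTop (nhds 0)

open Nat.Partrec

theorem enc_sorted (l : List ℕ) (h : l.SortedLT) : Encodable.encode l.toFinset = Encodable.encode l := by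
  have h1 : l.toFinset.val = (l : Multiset ℕ) := by
    simp [List.toFinset_val, h.nodup.dedup]
  have : Encodable.encode l.toFinset = Encodable.encode l.toFinset.val := rfl
  rw [this, h1]
  rw [show Encodable.encode (l : Multiset ℕ) = encodeMultiset (l : Multiset ℕ) from rfl]
  unfold encodeMultiset
  change Encodable.encode (List.mergeSort l _) = _
  rw [List.mergeSort_of_pairwise]
  refine h.sortedLE.pairwise.imp fun hab => ?_
  exact decide_eq_true hab

theorem cmap {α β γ : Type*} [Primcodable α] [Primcodable β] [Primcodable γ] 
    {f : α → List β} {g : α → β → γ} (hf : Computable f) (hg : Computable₂ g) :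
    Computable fun a => (f a).map (g a) := by
  have : Computable fun a => Nat.rec (motive := fun _ => List γ) []
      (fun y IH => (((f a)[y]?).map fun b => IH ++ [g a b]).getD IH) (f a).length := by
    refine Computable.nat_rec (h := fun a p => (((f a)[p.1]?).map fun b => p.2 ++ [g a b]).getD p.2) (Computable.list_length.comp hf) (Computable.const []) ?_
    refine Computable.option_getD (Computable.option_map ?_ ?_) (Computable.snd.comp Computable.snd)
    · exact Computable.list_getElem?.comp (hf.comp Computable.fst) (Computable.fst.comp Computable.snd)
    · exact Computable.list_concat.comp (Computable.snd.comp (Computable.snd.comp Computable.fst))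
        (hg.comp (Computable.fst.comp Computable.fst) Computable.snd)
  refine this.of_eq fun a => ?_
  have key : ∀ n ≤ (f a).length, Nat.rec (motive := fun _ => List γ) []
      (fun y IH => (((f a)[y]?).map fun b => IH ++ [g a b]).getD IH) n = ((f a).take n).map (g a) := by
    intro n
    induction n with
    | zero => simp
    | succ n ih =>
      intro h
      have := ih (by omega)
      simp only at this ⊢
      rw [this, List.getElem?_eq_getElem (by omega)]
      simp only [Option.map_some, Option.getD_some, ← List.take_concat_get' _ _ (show n < (f a).length by omega), List.map_append, List.map_cons, List.map_nil]
  rw [key _ le_rfl, List.take_length]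

def srt (L : List ℕ) : List ℕ := (List.range (L.foldr (· + ·) 0 + 1)).filter (fun x => ∃ a ∈ L, a = x)

theorem srt_prim : Primrec srt := by
  have h : PrimrecRel fun (x : ℕ) (L : List ℕ) => ∃ a ∈ L, a = x := by
    have := (PrimrecRel.exists_mem_list (α := ℕ) (β := ℕ) (R := fun a b => a = b) Primrec.eq).swap
    exact this
  have h2 := h.listFilter
  refine h2.comp (Primrec.list_range.comp (Primrec.succ.comp ?_)) Primrec.id
  exact Primrec.list_foldr (h := fun _ p => p.1 + p.2) Primrec.id (Primrec.const 0) (Primrec.nat_add.comp (Primrec.fst.comp Primrec.snd) (Primrec.snd.comp Primrec.snd))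

theorem srt_sorted (L) : (srt L).SortedLT := by
  unfold srt
  exact (List.Pairwise.filter _ List.pairwise_lt_range).sortedLT

theorem srt_fin (L) : (srt L).toFinset = L.toFinset := by
  ext x
  simp only [srt, List.mem_toFinset, List.mem_filter, List.mem_range, decide_eq_true_eq]
  constructor
  · rintro ⟨_, a, h, rfl⟩; exact h
  · intro h
    exact ⟨Nat.lt_succ_of_le (List.le_sum_of_mem h), x, h, rfl⟩

/-- convergence within k steps -/
def conv (e n x k : ℕ) : Bool :=
  ((Code.evaln k (Denumerable.ofNat Code e) n).bind fun c => Code.evaln k (Denumerable.ofNat Code c) x).isSome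

def fired (e s n : ℕ) : Bool :=
  decide (n = s.unpair.1) && (conv e n s.unpair.2.unpair.1 (s.unpair.2.unpair.2 + 1) &&
    !conv e n s.unpair.2.unpair.1 s.unpair.2.unpair.2)

theorem conv_prim : Primrec fun p : (ℕ × ℕ) × (ℕ × ℕ) => conv p.1.1 p.1.2 p.2.1 p.2.2 := by
  unfold conv
  refine Primrec.option_isSome.comp (Primrec.option_bind ?_ ?_)
  · exact Code.primrec_evaln.comp (((Primrec.snd.comp Primrec.snd).pair ((Primrec.ofNat Code).comp (Primrec.fst.comp Primrec.fst))).pair (Primrec.snd.comp Primrec.fst))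
  · exact Code.primrec_evaln.comp (((Primrec.snd.comp (Primrec.snd.comp Primrec.fst)).pair ((Primrec.ofNat Code).comp Primrec.snd)).pair (Primrec.fst.comp (Primrec.snd.comp Primrec.fst)))

theorem fired_prim : Primrec fun p : (ℕ × ℕ) × ℕ => fired p.1.1 p.1.2 p.2 := by
  unfold fired
  have hs : Primrec fun p : (ℕ × ℕ) × ℕ => p.1.2 := Primrec.snd.comp Primrec.fst
  have he : Primrec fun p : (ℕ × ℕ) × ℕ => p.1.1 := Primrec.fst.comp Primrec.fst
  have hn : Primrec fun p : (ℕ × ℕ) × ℕ => p.2 := Primrec.snd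
  have hu := Primrec.unpair.comp hs
  have hv := Primrec.unpair.comp (Primrec.snd.comp hu)
  have hx := Primrec.fst.comp hv
  have hk := Primrec.snd.comp hv
  refine Primrec.and.comp ?_ (Primrec.and.comp ?_ (Primrec.not.comp ?_))
  · exact (Primrec.eq.comp hn (Primrec.fst.comp hu)).decide
  · exact conv_prim.comp ((he.pair hn).pair (hx.pair (Primrec.succ.comp hk)))
  · exact conv_prim.comp ((he.pair hn).pair (hx.pair hk))

theorem conv_mono {e n x k k' : ℕ} (h : k ≤ k') (hc : conv e n x k = true) : conv e n x k' = true := by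
  simp only [conv, Option.isSome_iff_exists, Option.bind_eq_some_iff] at *
  obtain ⟨y, c, h1, h2⟩ := hc
  exact ⟨y, c, Code.evaln_mono h h1, Code.evaln_mono h h2⟩

theorem conv_iff (e n x : ℕ) : (∃ k, conv e n x k = true) ↔
    ∃ c : ℕ, c ∈ (Denumerable.ofNat Code e).eval n ∧ ((Denumerable.ofNat Code c).eval x).Dom := by
  simp only [conv, Option.isSome_iff_exists, Option.bind_eq_some_iff]
  constructor
  · rintro ⟨k, y, c, h1, h2⟩
    exact ⟨c, Code.evaln_sound h1, Part.dom_iff_mem.2 ⟨y, Code.evaln_sound h2⟩⟩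
  · rintro ⟨c, h1, h2⟩
    obtain ⟨y, h2⟩ := Part.dom_iff_mem.1 h2
    obtain ⟨k, h1⟩ := Code.evaln_complete.1 h1
    obtain ⟨k', h2⟩ := Code.evaln_complete.1 h2
    exact ⟨max k k', y, c, Code.evaln_mono (le_max_left _ _) h1, Code.evaln_mono (le_max_right _ _) h2⟩

theorem conv_zero (e n x) : conv e n x 0 = false := by simp [conv, Code.evaln]

theorem fired_spec (e n x k : ℕ) : fired e (Nat.pair n (Nat.pair x k)) n = true ↔ conv e n x (k+1) = true ∧ conv e n x k = false := by
  simp [fired]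

theorem fired_inf (e n : ℕ) : {s | fired e s n = true}.Finite ↔ {x | ∃ k, conv e n x k = true}.Finite := by
  constructor
  · intro h
    refine (h.image (fun s => s.unpair.2.unpair.1)).subset ?_
    intro x hx
    have hx : ∃ k, conv e n x k = true := hx
    have h0 : Nat.find hx ≠ 0 := fun h => by
      have := Nat.find_spec hx
      rw [h, conv_zero] at this; cases this
    obtain ⟨k, hk⟩ := Nat.exists_eq_succ_of_ne_zero h0
    refine ⟨Nat.pair n (Nat.pair x k), (fired_spec ..).2 ⟨?_, ?_⟩, by simp⟩
    · have := Nat.find_spec hx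
      rwa [hk] at this
    · have := Nat.find_min hx (m := k) (by omega)
      simpa using this
  · intro h
    refine Set.Finite.of_finite_image (f := fun s => s.unpair.2.unpair.1) (h.subset ?_) ?_
    · rintro _ ⟨s, hs, rfl⟩
      simp only [fired, Set.mem_ofPred_eq, Bool.and_eq_true] at hs
      exact ⟨_, hs.2.1⟩
    · intro s hs t ht hst
      simp only [fired, Set.mem_ofPred_eq, Bool.and_eq_true, decide_eq_true_eq, Bool.not_eq_true'] at hs ht hst
      rw [← Nat.pair_unpair s, ← Nat.pair_unpair t, ← hs.1, ← ht.1, ← Nat.pair_unpair s.unpair.2, ← Nat.pair_unpair t.unpair.2, ← hst]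
      rw [← hst] at ht
      congr 2
      by_contra hne
      rcases Nat.lt_or_gt_of_ne hne with hlt | hlt
      · have := conv_mono hlt hs.2.1
        rw [ht.2.2] at this; cases this
      · have := conv_mono hlt ht.2.1
        rw [hs.2.2] at this; cases this

theorem icc_step (b : ℕ →₀ ℤ) (hb : 0 ≤ b) (k j : ℕ) (hj : j ≤ 1) :
    Finset.Icc 0 b ∪ (Finset.Icc 0 b).image (Finsupp.single k (j:ℤ) + ·) = Finset.Icc 0 (b + Finsupp.single k (j:ℤ)) := by
  ext g
  simp only [Finset.mem_union, Finset.mem_image, Finset.mem_Icc]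
  have hs : (0 : ℕ →₀ ℤ) ≤ Finsupp.single k (j:ℤ) := by
    intro i; rw [Finsupp.single_apply]; split <;> simp
  constructor
  · rintro (⟨h1, h2⟩ | ⟨a, ⟨h1, h2⟩, rfl⟩)
    · exact ⟨h1, h2.trans (by simp)⟩
    · refine ⟨add_nonneg hs h1, ?_⟩
      rw [add_comm]; gcongr
  · rintro ⟨h1, h2⟩
    by_cases h : g ≤ b
    · exact Or.inl ⟨h1, h⟩
    · right
      have hk : b k < g k := by
        by_contra hk
        apply h
        intro i
        by_cases hi : i = k
        · subst hi; omega
        · have := h2 i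
          simpa [Finsupp.single_apply, Ne.symm hi] using this
      refine ⟨g - Finsupp.single k (j:ℤ), ⟨?_, ?_⟩, by simp⟩
      · intro i
        have := h1 i
        have hbk := hb k
        by_cases hi : i = k
        · subst hi
          simp at this hbk ⊢
          omega
        · simpa [Finsupp.single_apply, Ne.symm hi] using this
      · simpa using h2

theorem box_card (b : ℕ →₀ ℤ) (hb : 0 ≤ b) (n : ℕ) :
    ((Finset.Icc 0 b).card : ℝ) = (b n + 1) * ((Finset.Icc 0 (b.erase n)).card : ℝ) := by
  have hbn : 0 ≤ b n := hb n
  have h1 : (Finset.Icc 0 b).card = ∏ i ∈ insert n b.support, (Finset.Icc 0 (b i)).card := by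
    rw [Finsupp.card_Icc]
    simp only [Finsupp.support_zero, Finset.empty_union, Finsupp.coe_zero, Pi.zero_apply]
    refine Finset.prod_subset (Finset.subset_insert _ _) ?_
    intro i _ hi
    simp at hi
    simp [hi]
  have h2 : (Finset.Icc 0 (b.erase n)).card = ∏ i ∈ b.support.erase n, (Finset.Icc 0 (b i)).card := by
    rw [Finsupp.card_Icc]
    simp only [Finsupp.support_zero, Finset.empty_union, Finsupp.coe_zero, Pi.zero_apply, Finsupp.support_erase]
    refine Finset.prod_congr rfl ?_
    intro i hi
    rw [Finsupp.erase_ne (Finset.ne_of_mem_erase hi)]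
  rw [h1, h2, ← Finset.mul_prod_erase (insert n b.support) _ (Finset.mem_insert_self n _), Finset.erase_insert_eq_erase]
  push_cast
  congr 1
  rw [Int.card_Icc]
  have : (((b n + 1 - 0).toNat : ℤ)) = b n + 1 := by omega
  exact_mod_cast this

theorem box_sdiff (b : ℕ →₀ ℤ) (hb : 0 ≤ b) (n : ℕ) :
    Finset.Icc 0 b \ (Finset.Icc 0 b).image (Finsupp.single n (1:ℤ) + ·) = Finset.Icc 0 (b.erase n) := by
  ext g
  simp only [Finset.mem_sdiff, Finset.mem_image, Finset.mem_Icc]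
  constructor
  · rintro ⟨⟨h1, h2⟩, h3⟩
    refine ⟨h1, fun i => ?_⟩
    by_cases hi : i = n
    · subst hi
      by_contra hlt
      simp at hlt
      refine h3 ⟨g - Finsupp.single i 1, ⟨?_, ?_⟩, by simp⟩
      · intro j
        have := h1 j
        by_cases hj : j = i
        · subst hj; simp; omega
        · simpa [Finsupp.single_apply, Ne.symm hj] using this
      · refine le_trans ?_ h2
        intro j
        by_cases hj : j = i
        · subst hj; simp
        · simp [Ne.symm hj]
    · rw [Finsupp.erase_ne hi]; exact h2 i
  · rintro ⟨h1, h2⟩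
    have hn := h2 n
    simp only [Finsupp.erase_same] at hn
    refine ⟨⟨h1, fun i => ?_⟩, ?_⟩
    · by_cases hi : i = n
      · subst hi; exact hn.trans (hb i)
      · have := h2 i
        rwa [Finsupp.erase_ne hi] at this
    · rintro ⟨a, ⟨h3, h4⟩, rfl⟩
      have := h3 n
      simp at hn this
      omega

theorem box_ratio (b : ℕ →₀ ℤ) (hb : 0 ≤ b) (n : ℕ) :
    ((Finset.Icc 0 b \ (Finset.Icc 0 b).image (Finsupp.single n (1:ℤ) + ·)).card : ℝ) / (Finset.Icc 0 b).card = 1 / ((b n : ℝ) + 1) := by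
  rw [box_sdiff b hb, box_card b hb n]
  have hbn : 0 ≤ b n := hb n
  have : (0:ℝ) < b n + 1 := by exact_mod_cast (by omega : 0 < b n + 1)
  have h2 : (Finset.Icc 0 (b.erase n)).card ≠ 0 := by
    rw [Finset.card_ne_zero]
    refine ⟨0, Finset.mem_Icc.2 ⟨le_rfl, fun i => ?_⟩⟩
    by_cases hi : i = n
    · subst hi; simp
    · rw [Finsupp.erase_ne hi]; exact hb i
  field_simp

theorem folner_gen (A : ℕ → Finset (ℕ →₀ ℤ))
    (h : ∀ n : ℕ, Tendsto (fun s => ((A s \ (A s).image (Finsupp.single n (1:ℤ) + ·)).card : ℝ) / (A s).card) atTop (nhds 0))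
    (g : ℕ →₀ ℤ) :
    Tendsto (fun s => ((A s \ (A s).image (g + ·)).card : ℝ) / (A s).card) atTop (nhds 0) := by
  let P (g : ℕ →₀ ℤ) : Prop := Tendsto (fun s => ((A s \ (A s).image (g + ·)).card : ℝ) / (A s).card) atTop (nhds 0)
  have hinj (g : ℕ →₀ ℤ) : Function.Injective (g + ·) := add_right_injective g
  have hadd : ∀ g g', P g → P g' → P (g + g') := by
    intro g g' h1 h2
    have := h1.add h2
    rw [add_zero] at this
    refine squeeze_zero (fun s => by positivity) (fun s => ?_) this
    rw [← add_div]
    gcongr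
    norm_cast
    have e1 : (A s \ (A s).image (g' + ·)).card = ((A s).image (g + ·) \ (A s).image ((g + g') + ·)).card := by
      rw [← Finset.card_image_of_injective _ (hinj g), Finset.image_sdiff _ _ (hinj g), Finset.image_image]
      congr 3
      ext x : 1
      simp [add_assoc]
    rw [e1]
    refine (Finset.card_le_card ?_).trans (Finset.card_union_le _ _)
    intro x
    simp only [Finset.mem_sdiff, Finset.mem_union]
    tauto
  have hneg : ∀ g, P g → P (-g) := by
    intro g h1
    refine h1.congr fun s => ?_
    congr 2
    have e1 : (A s \ (A s).image (-g + ·)).card = ((A s).image (g + ·) \ A s).card := by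
      rw [← Finset.card_image_of_injective _ (hinj g), Finset.image_sdiff _ _ (hinj g), Finset.image_image]
      congr 2
      ext x : 1
      simp
    rw [e1]
    apply Finset.card_sdiff_comm
    rw [Finset.card_image_of_injective _ (hinj g)]
  have hzero : P 0 := by
    simp only [P, zero_add, Finset.image_id', sdiff_self]
    simp
  change P g
  induction g using Finsupp.induction_linear with
  | zero => exact hzero
  | add f g hf hg => exact hadd _ _ hf hg
  | single n z =>
    induction z using Int.induction_on with
    | zero => simpa using hzero
    | succ i ih => rw [Finsupp.single_add]; exact hadd _ _ ih (h n)
    | pred i ih => rw [sub_eq_add_neg, Finsupp.single_add, Finsupp.single_neg n (1:ℤ)]; exact hadd _ _ ih (hneg _ (h n))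

/-- value (0 or 1) used at step `t` of stage `s` -/
def wt (e s n : ℕ) : ℕ := bif fired e s n then 0 else 1

theorem wt_prim : Primrec fun p : (ℕ × ℕ) × ℕ => wt p.1.1 p.1.2 p.2 :=
  Primrec.cond fired_prim (Primrec.const 0) (Primrec.const 1)

theorem wt_le (e s n : ℕ) : wt e s n ≤ 1 := by
  unfold wt; cases fired e s n <;> simp

/-- top corner of the box -/
noncomputable def corner (e s t : ℕ) : ℕ →₀ ℤ :=
  ∑ i ∈ Finset.range t, Finsupp.single i.unpair.1 (wt e s i.unpair.1 : ℤ)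

theorem corner_nonneg (e s t : ℕ) : 0 ≤ corner e s t := by
  refine Finset.sum_nonneg fun i _ j => ?_
  rw [Finsupp.single_apply]; split <;> simp

theorem corner_apply (e s t n : ℕ) : corner e s t n =
    (wt e s n : ℤ) * ((Finset.range t).filter (fun i => i.unpair.1 = n)).card := by
  unfold corner
  rw [Finsupp.finsetSum_apply, Finset.card_filter]
  push_cast
  rw [Finset.mul_sum]
  refine Finset.sum_congr rfl fun i _ => ?_
  rw [Finsupp.single_apply]
  split
  · rename_i h; simp [h]
  · simp

theorem count_tendsto (n : ℕ) :
    Tendsto (fun s => (((Finset.range s).filter (fun i => i.unpair.1 = n)).card : ℝ)) atTop atTop := by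
  refine tendsto_natCast_atTop_atTop.comp ?_
  refine tendsto_atTop_atTop_of_monotone ?_ ?_
  · intro s t h
    exact Finset.card_le_card (Finset.filter_subset_filter _ (Finset.range_mono h))
  · intro M
    refine ⟨(Finset.range M).sup (fun j => Nat.pair n j) + 1, ?_⟩
    calc M = ((Finset.range M).image (fun j => Nat.pair n j)).card := by
            rw [Finset.card_image_of_injective, Finset.card_range]
            intro a b h
            simpa using h
      _ ≤ _ := by
        apply Finset.card_le_card
        intro x hx
        obtain ⟨j, hj, rfl⟩ := Finset.mem_image.1 hx
        simp only [Finset.mem_filter, Finset.mem_range, Nat.unpair_pair, and_true]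
        exact Nat.lt_succ_of_le (Finset.le_sup (f := fun j => Nat.pair n j) hj)

/-- list of codes of the points in the box -/
def pts (add : ℕ → ℕ → ℕ) (sing : ℕ → ℕ → ℕ) (e s t : ℕ) : List ℕ :=
  Nat.rec [sing 0 0] (fun i L => L ++ L.map (add (sing i.unpair.1 (wt e s i.unpair.1)))) t

theorem step_aux {α : Type} [Primcodable α] {add : ℕ → ℕ → ℕ} {sing : ℕ → ℕ → ℕ}
    (ha : Computable₂ add) (hs : Computable₂ sing)
    {L : α → List ℕ} {n w : α → ℕ} (hL : Computable L) (hn : Computable n) (hw : Computable w) :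
    Computable fun a => L a ++ (L a).map (add (sing (n a) (w a))) := by
  have hv : Computable fun a => sing (n a) (w a) := Computable₂.comp hs hn hw
  have hg : Computable₂ fun (a : α) (m : ℕ) => add (sing (n a) (w a)) m :=
    Computable₂.comp ha (Computable.comp hv Computable.fst) Computable.snd
  exact Computable₂.comp Computable.list_append hL (cmap hL hg)

theorem step_comp (add : ℕ → ℕ → ℕ) (sing : ℕ → ℕ → ℕ) (ha : Computable₂ add) (hs : Computable₂ sing)
    (w : (ℕ × ℕ) × ℕ → ℕ) (hw : Computable w) :
    Computable₂ fun (p : ℕ × ℕ) (q : ℕ × List ℕ) =>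
      q.2 ++ q.2.map (add (sing q.1.unpair.1 (w (p, q.1.unpair.1)))) := by
  have hn : Computable fun x : (ℕ × ℕ) × (ℕ × List ℕ) => x.2.1.unpair.1 :=
    Computable.fst.comp (Computable.unpair.comp (Computable.fst.comp Computable.snd))
  exact step_aux (α := (ℕ × ℕ) × (ℕ × List ℕ)) ha hs (Computable.snd.comp Computable.snd) hn
    (hw.comp (Computable.fst.pair hn))

theorem pts_comp (add : ℕ → ℕ → ℕ) (sing : ℕ → ℕ → ℕ) (ha : Computable₂ add) (hs : Computable₂ sing) :
    Computable fun p : ℕ × ℕ => pts add sing p.1 p.2 p.2 :=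
  Computable.nat_rec (f := fun p : ℕ × ℕ => p.2) (g := fun _ => [sing 0 0])
    Computable.snd (Computable.const _) (step_comp add sing ha hs _ wt_prim.to_comp)

theorem pts_image (ν : ℕ → (ℕ →₀ ℤ)) (add : ℕ → ℕ → ℕ) (sing : ℕ → ℕ → ℕ)
    (haddν : ∀ i j, ν (add i j) = ν i + ν j)
    (hsingν : ∀ i k, ν (sing i k) = Finsupp.single i (k : ℤ)) (e s t : ℕ) :
    (pts add sing e s t).toFinset.image ν = Finset.Icc 0 (corner e s t) := by
  induction t with
  | zero => simp [pts, corner, hsingν]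
  | succ t ih =>
    have h1 : pts add sing e s (t+1) = pts add sing e s t ++ (pts add sing e s t).map (add (sing t.unpair.1 (wt e s t.unpair.1))) := rfl
    have h2 : corner e s (t+1) = corner e s t + Finsupp.single t.unpair.1 (wt e s t.unpair.1 : ℤ) := by
      simp [corner, Finset.sum_range_succ]
    rw [h1, h2, ← icc_step _ (corner_nonneg e s t) _ _ (wt_le e s _), ← ih, List.toFinset_append, Finset.image_union]
    congr 1
    ext g
    simp only [Finset.mem_image, List.mem_toFinset, List.mem_map, exists_exists_and_eq_and, haddν, hsingν]

theorem corner_tendsto (e n : ℕ) :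
    Tendsto (fun s => 1 / ((corner e s s n : ℝ) + 1)) atTop (nhds 0) ↔ {s | fired e s n = true}.Finite := by
  constructor
  · intro h
    have h2 := h.eventually (gt_mem_nhds (show (0:ℝ) < 1 by norm_num))
    obtain ⟨N, hN⟩ := eventually_atTop.1 h2
    refine (Set.finite_lt_nat N).subset fun s hs => ?_
    by_contra hlt
    have hs : fired e s n = true := hs
    have := hN s (not_lt.1 hlt)
    simp [corner_apply, wt, hs] at this
  · intro h
    obtain ⟨N, hN⟩ := h.bddAbove
    have := (tendsto_atTop_add_const_right _ (1:ℝ) (count_tendsto n)).const_div_atTop 1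
    refine this.congr' ?_
    filter_upwards [eventually_gt_atTop N] with s hs
    have : fired e s n = false := by
      by_contra hf
      have := hN (show s ∈ {s | fired e s n = true} by simpa using hf)
      omega
    simp [corner_apply, wt, this]

theorem stmt6 (ν : ℕ → (ℕ →₀ ℤ)) (hbij : Function.Bijective ν)
    -- ν is a standard effective bijective numbering of ⊕_{n∈ℕ} ℤ:
    (add : ℕ → ℕ → ℕ) (neg : ℕ → ℕ) (sing : ℕ → ℕ → ℕ)
    (haddc : Computable₂ add) (hnegc : Computable neg) (hsingc : Computable₂ sing)
    (haddν : ∀ i j, ν (add i j) = ν i + ν j) (hnegν : ∀ i, ν (neg i) = -(ν i))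
    (hsingν : ∀ i k, ν (sing i k) = Finsupp.single i (k : ℤ)) :
    ∃ h : ℕ → ℕ, Computable h ∧
      ∀ e : ℕ,
        ∃ F : ℕ → Finset ℕ,
          -- φ_{h(e)} is total and each value is the canonical index of a nonempty finite set
          (∀ s, Encodable.encode (F s) ∈ phi (h e) s) ∧ (∀ s, (F s).Nonempty) ∧
          -- (ν(F_s)) is a Følner sequence iff for every n the set
          -- {x : φ_e(n) ↓ = c and x ∈ W_c} is finite
          (IsFolnerSeq ν F ↔
            ∀ n : ℕ, {x : ℕ | ∃ c : ℕ, c ∈ phi e n ∧ (phi c x).Dom}.Finite) := by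
  have hG : Computable fun p : ℕ × ℕ => Encodable.encode (srt (pts add sing p.1 p.2 p.2)) :=
    Computable.encode.comp (srt_prim.to_comp.comp (pts_comp add sing haddc hsingc))
  have hG' : Nat.Partrec fun m : ℕ => Part.some (Encodable.encode (srt (pts add sing m.unpair.1 m.unpair.2 m.unpair.2))) :=
    Partrec.nat_iff.1 (hG.comp Computable.unpair).partrec
  obtain ⟨c, hc⟩ := Nat.Partrec.Code.exists_code.1 hG'
  refine ⟨fun e => Encodable.encode (c.curry e), ?_, fun e => ?_⟩
  · exact Computable.encode.comp
      (Nat.Partrec.Code.primrec₂_curry.comp (Primrec.const c) Primrec.id).to_comp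
  have himg := pts_image ν add sing haddν hsingν e
  refine ⟨fun s => (pts add sing e s s).toFinset, fun s => ?_, fun s => ?_, ?_⟩
  · simp only [phi, Denumerable.ofNat_encode]
    rw [Nat.Partrec.Code.eval_curry, hc, ← srt_fin, enc_sorted _ (srt_sorted _)]
    simp
  · rw [← Finset.image_nonempty (f := ν), himg]
    exact ⟨0, Finset.mem_Icc.2 ⟨le_rfl, corner_nonneg e s s⟩⟩
  · have key : ∀ n : ℕ, {x : ℕ | ∃ c : ℕ, c ∈ phi e n ∧ (phi c x).Dom}.Finite ↔
        Tendsto (fun s => 1 / ((corner e s s n : ℝ) + 1)) atTop (nhds 0) := by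
      intro n
      rw [corner_tendsto, fired_inf]
      simp only [conv_iff, phi]
    simp only [key, IsFolnerSeq, himg]
    constructor
    · intro h n
      exact (h (Finsupp.single n 1)).congr fun s => box_ratio _ (corner_nonneg e s s) n
    · intro h g
      refine folner_gen (fun s => Finset.Icc 0 (corner e s s)) (fun n => ?_) g
      exact (h n).congr fun s => (box_ratio _ (corner_nonneg e s s) n).symm
end
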